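/- Let ε > 0, β ∈ ℝ, let φ : ℝ → ℂ be twice continuously differentiable, and set u_ε(y) = (πε)^{-1/4} exp(−y²/(2ε)), f(y) = ∫_ℝ sgn(y−y′) u_ε(y′)² dy′, Φ(x,y) = φ(x) u_ε(y), and T(x,y) = (−πβ f(y)|φ(x)|², 0). Then for every x ∈ ℝ, ∫_ℝ [ (−i∇ + T)² Φ ](x,y) u_ε(y) dy = −φ''(x) + (π²β²/3) |φ(x)|⁴ φ(x) + φ(x) ∫_ℝ ( −u_ε''(y) ) u_ε(y) dy, where (−i∇ + T)²Φ = (i∂_x + πβ f(y)|φ(x)|²)² Φ − ∂_y² Φ. -/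

import Mathlib

open MeasureTheory

/-- The Gaussian ground state `u_ε(y) = (πε)^{-1/4} exp(−y²/(2ε))`. -/
noncomputable def uGauss (ε y : ℝ) : ℝ :=
  (Real.pi * ε) ^ (-(1/4 : ℝ)) * Real.exp (-(y^2) / (2*ε))

/-- `f(y) = ∫ sgn(y−y′) u_ε(y′)² dy′`. -/
noncomputable def fSgn (ε y : ℝ) : ℝ :=
  ∫ y' : ℝ, Real.sign (y - y') * (uGauss ε y')^2

/-- The quasi-1D ansatz `Φ(x,y) = φ(x) u_ε(y)`. -/
noncomputable def PhiAnsatz (ε : ℝ) (φ : ℝ → ℂ) (p : ℝ × ℝ) : ℂ :=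
  φ p.1 * ((uGauss ε p.2 : ℝ) : ℂ)

/-- The longitudinal covariant operator `i∂_x + πβ f(y)|φ(x)|²` (equal to `−(−i∂_x + T₁)`
in the gauge `T₁ = −πβ f(y)|φ(x)|²`). -/
noncomputable def opA (ε β : ℝ) (φ : ℝ → ℂ) (Ψ : ℝ × ℝ → ℂ) (p : ℝ × ℝ) : ℂ :=
  Complex.I * fderiv ℝ Ψ p (1, 0)
    + ((Real.pi * β * fSgn ε p.2 * ‖φ p.1‖^2 : ℝ) : ℂ) * Ψ p

/-- The magnetic Laplacian of the ansatz in the 1D-adapted gauge: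
`(−i∇ + T)²Φ = (i∂_x + πβ f(y)|φ(x)|²)² Φ − ∂_y² Φ`. -/
noncomputable def magLapAnsatz (ε β : ℝ) (φ : ℝ → ℂ) (p : ℝ × ℝ) : ℂ :=
  opA ε β φ (opA ε β φ (PhiAnsatz ε φ)) p
    - fderiv ℝ (fun q => fderiv ℝ (PhiAnsatz ε φ) q (0, 1)) p (0, 1)

lemma aux_sq (ε y : ℝ) (hε : 0 < ε) : (uGauss ε y)^2 = (Real.sqrt (Real.pi * ε))⁻¹ * Real.exp (-(1/ε) * y^2) := by
  have hp : 0 < Real.pi * ε := by positivity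
  unfold uGauss
  rw [mul_pow, ← Real.exp_nat_mul, ← Real.rpow_natCast, ← Real.rpow_mul hp.le, Real.sqrt_eq_rpow,
    ← Real.rpow_neg hp.le]
  congr 2
  · norm_num
  · push_cast
    field_simp

lemma aux_int (ε : ℝ) (hε : 0 < ε) : Integrable (fun y => (uGauss ε y)^2) := by
  simp_rw [aux_sq ε _ hε]
  exact (integrable_exp_neg_mul_sq (by positivity)).const_mul _

lemma aux_int2 (ε : ℝ) (hε : 0 < ε) : Integrable (fun y => y^2 * (uGauss ε y)^2) := by
  simp_rw [aux_sq ε _ hε]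
  have h := (integrable_rpow_mul_exp_neg_mul_sq (b := 1/ε) (by positivity) (s := 2) (by norm_num)).const_mul
    (Real.sqrt (Real.pi * ε))⁻¹
  refine h.congr (Filter.Eventually.of_forall fun y => ?_)
  simp only [Real.rpow_ofNat]
  ring

lemma aux_one (ε : ℝ) (hε : 0 < ε) : ∫ y, (uGauss ε y)^2 = 1 := by
  simp_rw [aux_sq ε _ hε]
  rw [integral_const_mul, integral_gaussian]
  have hp : 0 < Real.pi * ε := by positivity
  have : Real.pi / (1/ε) = Real.pi * ε := by field_simp
  rw [this]
  exact inv_mul_cancel₀ (Real.sqrt_pos.2 hp).ne'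

lemma aux_d1 (ε y : ℝ) (hε : 0 < ε) : HasDerivAt (uGauss ε) (-(y/ε) * uGauss ε y) y := by
  have h := ((((hasDerivAt_id y).pow 2).neg.div_const (2*ε)).exp).const_mul
    ((Real.pi * ε) ^ (-(1/4 : ℝ)))
  unfold uGauss
  refine HasDerivAt.congr_deriv h ?_
  simp
  field_simp

lemma aux_d2 (ε y : ℝ) (hε : 0 < ε) :
    HasDerivAt (fun y => -(y/ε) * uGauss ε y) ((y^2/ε^2 - 1/ε) * uGauss ε y) y := by
  have h := ((hasDerivAt_id y).div_const ε).neg.mul (aux_d1 ε y hε)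
  refine HasDerivAt.congr_deriv h ?_
  simp
  field_simp
  ring

lemma aux_cont (ε : ℝ) : Continuous (fun y => (uGauss ε y)^2) := by
  unfold uGauss
  fun_prop

lemma aux_sign_meas : Measurable Real.sign := by
  unfold Real.sign
  exact Measurable.ite measurableSet_Iio measurable_const
    (Measurable.ite measurableSet_Ioi measurable_const measurable_const)

lemma aux_sign_le (r : ℝ) : ‖Real.sign r‖ ≤ 1 := by
  rcases Real.sign_apply_eq r with h | h | h <;> simp [h]

lemma aux_bd (ε y : ℝ) (hε : 0 < ε) : ‖fSgn ε y‖ ≤ 1 := by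
  unfold fSgn
  rw [← aux_one ε hε]
  refine norm_integral_le_of_norm_le (aux_int ε hε) (Filter.Eventually.of_forall fun t => ?_)
  rw [norm_mul, Real.norm_of_nonneg (sq_nonneg (uGauss ε t))]
  exact mul_le_of_le_one_left (sq_nonneg _) (aux_sign_le _)

lemma aux_lim (ε c : ℝ) (l : Filter ℝ) [l.IsCountablyGenerated] (hε : 0 < ε)
    (h : ∀ t, ∀ᶠ y in l, Real.sign (y - t) = c) :
    Filter.Tendsto (fSgn ε) l (nhds c) := by
  have e : c = ∫ y', c * (uGauss ε y')^2 := by rw [integral_const_mul, aux_one ε hε, mul_one]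
  rw [e]
  unfold fSgn
  refine tendsto_integral_filter_of_dominated_convergence (fun t => (uGauss ε t)^2) ?_ ?_
    (aux_int ε hε) ?_
  · refine Filter.Eventually.of_forall fun y => ?_
    exact ((aux_sign_meas.comp (measurable_const.sub measurable_id)).mul
      (aux_cont ε).measurable).aestronglyMeasurable
  · refine Filter.Eventually.of_forall fun y => Filter.Eventually.of_forall fun t => ?_
    rw [norm_mul, Real.norm_of_nonneg (sq_nonneg (uGauss ε t))]
    exact mul_le_of_le_one_left (sq_nonneg _) (aux_sign_le _)
  · refine Filter.Eventually.of_forall fun t => ?_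
    refine tendsto_const_nhds.congr' ?_
    filter_upwards [h t] with y hy
    rw [hy]

lemma aux_top (ε : ℝ) (hε : 0 < ε) : Filter.Tendsto (fSgn ε) Filter.atTop (nhds 1) := by
  refine aux_lim ε 1 _ hε fun t => ?_
  filter_upwards [Filter.eventually_gt_atTop t] with y hy
  exact Real.sign_of_pos (sub_pos.2 hy)

lemma aux_bot (ε : ℝ) (hε : 0 < ε) : Filter.Tendsto (fSgn ε) Filter.atBot (nhds (-1)) := by
  refine aux_lim ε (-1) _ hε fun t => ?_
  filter_upwards [Filter.eventually_lt_atBot t] with y hy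
  exact Real.sign_of_neg (sub_neg.2 hy)

lemma aux_f (ε y : ℝ) (hε : 0 < ε) :
    fSgn ε y = 2 * (∫ t in Set.Iic y, (uGauss ε t)^2) - 1 := by
  rw [← aux_one ε hε, ← integral_indicator measurableSet_Iic, ← integral_const_mul, ← integral_sub
    (((aux_int ε hε).indicator measurableSet_Iic).const_mul 2) (aux_int ε hε)]
  unfold fSgn
  refine integral_congr_ae ?_
  have : ∀ᵐ t : ℝ, t ≠ y := by simp [ae_iff]
  filter_upwards [this] with t ht
  rcases lt_or_gt_of_ne ht with h | h
  · rw [Real.sign_of_pos (sub_pos.2 h), Set.indicator_of_mem (by exact h.le)]; ring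
  · rw [Real.sign_of_neg (sub_neg.2 h), Set.indicator_of_notMem (by simpa using h)]; ring

lemma aux_fd (ε y : ℝ) (hε : 0 < ε) : HasDerivAt (fSgn ε) (2 * (uGauss ε y)^2) y := by
  have e : fSgn ε = fun y => fSgn ε 0 + 2 * ∫ t in (0:ℝ)..y, (uGauss ε t)^2 := by
    funext y
    rw [aux_f ε y hε, aux_f ε 0 hε, ← intervalIntegral.integral_Iic_sub_Iic
      (aux_int ε hε).integrableOn (aux_int ε hε).integrableOn]
    ring
  rw [e]
  exact ((((aux_cont ε).integral_hasStrictDerivAt 0 y).hasDerivAt).const_mul 2).const_add _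

lemma aux_fc (ε : ℝ) (hε : 0 < ε) : Continuous (fSgn ε) :=
  continuous_iff_continuousAt.2 fun y => (aux_fd ε y hε).continuousAt

lemma aux_i1 (ε : ℝ) (hε : 0 < ε) : Integrable (fun y => fSgn ε y * (uGauss ε y)^2) :=
  (aux_int ε hε).bdd_mul (c := 1) (aux_fc ε hε).aestronglyMeasurable
    (Filter.Eventually.of_forall fun y => aux_bd ε y hε)

lemma aux_i2 (ε : ℝ) (hε : 0 < ε) : Integrable (fun y => fSgn ε y ^ 2 * (uGauss ε y)^2) := by
  have := (aux_i1 ε hε).bdd_mul (c := 1) (aux_fc ε hε).aestronglyMeasurable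
    (Filter.Eventually.of_forall fun y => aux_bd ε y hε)
  refine this.congr (Filter.Eventually.of_forall fun y => ?_)
  simp only
  ring

lemma aux_v1 (ε : ℝ) (hε : 0 < ε) : ∫ y, fSgn ε y * (uGauss ε y)^2 = 0 := by
  have := integral_of_hasDerivAt_of_tendsto (f := fun y => fSgn ε y ^ 2 / 4)
    (f' := fun y => fSgn ε y * (uGauss ε y)^2) (m := (-1)^2/4) (n := 1^2/4)
    (fun y => by
      refine HasDerivAt.congr_deriv (((aux_fd ε y hε).pow 2).div_const 4) ?_
      simp only [Nat.cast_ofNat, Nat.add_one_sub_one, pow_one]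
      ring) (aux_i1 ε hε)
    (((aux_bot ε hε).pow 2).div_const 4) (((aux_top ε hε).pow 2).div_const 4)
  rw [this]; norm_num

lemma aux_v2 (ε : ℝ) (hε : 0 < ε) : ∫ y, fSgn ε y ^ 2 * (uGauss ε y)^2 = 1/3 := by
  have := integral_of_hasDerivAt_of_tendsto (f := fun y => fSgn ε y ^ 3 / 6)
    (f' := fun y => fSgn ε y ^ 2 * (uGauss ε y)^2) (m := (-1)^3/6) (n := 1^3/6)
    (fun y => by
      refine HasDerivAt.congr_deriv (((aux_fd ε y hε).pow 3).div_const 6) ?_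
      simp only [Nat.cast_ofNat, Nat.add_one_sub_one]
      ring) (aux_i2 ε hε)
    (((aux_bot ε hε).pow 3).div_const 6) (((aux_top ε hε).pow 3).div_const 6)
  rw [this]; norm_num

lemma aux_prod (a : ℝ → ℂ) (b : ℝ → ℝ) (p : ℝ × ℝ) (a' : ℂ) (b' : ℝ)
    (ha : HasDerivAt a a' p.1) (hb : HasDerivAt b b' p.2) :
    ∃ L : ℝ × ℝ →L[ℝ] ℂ, HasFDerivAt (fun q : ℝ × ℝ => a q.1 * ((b q.2 : ℝ) : ℂ)) L p ∧
      L (1, 0) = a' * b p.2 ∧ L (0, 1) = a p.1 * b' := by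
  have h1 : HasFDerivAt (fun q : ℝ × ℝ => a q.1) _ p :=
    ha.hasFDerivAt.comp p hasFDerivAt_fst
  have h2 : HasFDerivAt (fun q : ℝ × ℝ => ((b q.2 : ℝ) : ℂ)) _ p :=
    hb.ofReal_comp.hasFDerivAt.comp p hasFDerivAt_snd
  refine ⟨_, h1.mul h2, ?_, ?_⟩
  · simp [mul_comm]
  · simp

lemma aux_opA (ε β : ℝ) (hε : 0 < ε) (φ : ℝ → ℂ) (hφ : ContDiff ℝ 2 φ) (p : ℝ × ℝ) :
    opA ε β φ (PhiAnsatz ε φ) p = (Complex.I * deriv φ p.1) * (uGauss ε p.2 : ℝ)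
      + ((Real.pi * β * ‖φ p.1‖^2 : ℝ) * φ p.1) * ((fSgn ε p.2 * uGauss ε p.2 : ℝ) : ℂ) := by
  have hd := (hφ.differentiable (by norm_num) p.1).hasDerivAt
  obtain ⟨L, hL, h1, -⟩ := aux_prod φ (uGauss ε) p _ _ hd (aux_d1 ε p.2 hε)
  have : fderiv ℝ (PhiAnsatz ε φ) p = L := hL.fderiv
  unfold opA
  rw [this, h1]
  unfold PhiAnsatz
  push_cast
  ring

lemma aux_mag (ε β : ℝ) (hε : 0 < ε) (φ : ℝ → ℂ) (hφ : ContDiff ℝ 2 φ) (x : ℝ) :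
    ∃ C : ℂ, ∀ y, magLapAnsatz ε β φ (x, y) * ((uGauss ε y : ℝ) : ℂ) =
      -(deriv (deriv φ) x) * (((uGauss ε y)^2 : ℝ) : ℂ)
      + C * ((fSgn ε y * (uGauss ε y)^2 : ℝ) : ℂ)
      + ((Real.pi^2 * β^2 : ℝ) : ℂ) * ((‖φ x‖^4 : ℝ) : ℂ) * φ x *
        ((fSgn ε y ^ 2 * (uGauss ε y)^2 : ℝ) : ℂ)
      + φ x * ((-(deriv (deriv (uGauss ε)) y) * uGauss ε y : ℝ) : ℂ) := by
  have hdiff : Differentiable ℝ φ := hφ.differentiable (by norm_num)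
  have hd2 : HasDerivAt (deriv φ) (deriv (deriv φ) x) x := by
    have : ContDiff ℝ 1 (deriv φ) := by
      have h2 : ContDiff ℝ (1+1) φ := by simpa [one_add_one_eq_two] using hφ
      exact (contDiff_succ_iff_deriv.1 h2).2.2
    exact (this.differentiable (by norm_num) x).hasDerivAt
  set G : ℝ → ℂ := fun x => (Real.pi * β * ‖φ x‖^2 : ℝ) * φ x with hG
  have hGd : HasDerivAt G (deriv G x) x := by
    have h0 : Differentiable ℝ (fun x => ‖φ x‖^2) := hdiff.norm_sq ℝ
    have h1 : DifferentiableAt ℝ (fun x => Real.pi * β * ‖φ x‖^2) x := (h0 x).const_mul _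
    exact (h1.hasDerivAt.ofReal_comp.mul (hdiff x).hasDerivAt).differentiableAt.hasDerivAt
  have hu1 : deriv (uGauss ε) = fun y => -(y/ε) * uGauss ε y :=
    funext fun y => (aux_d1 ε y hε).deriv
  refine ⟨Complex.I * deriv G x + (Real.pi * β * ‖φ x‖^2 : ℝ) * (Complex.I * deriv φ x), fun y => ?_⟩
  have e1 : opA ε β φ (PhiAnsatz ε φ) = fun p => (Complex.I * deriv φ p.1) * (uGauss ε p.2 : ℝ)
      + G p.1 * ((fSgn ε p.2 * uGauss ε p.2 : ℝ) : ℂ) := funext fun p => aux_opA ε β hε φ hφ p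
  obtain ⟨L1, hL1, h1, -⟩ := aux_prod (fun x => Complex.I * deriv φ x) (uGauss ε) (x, y) _ _
    (hd2.const_mul Complex.I) (aux_d1 ε y hε)
  obtain ⟨L2, hL2, h2, -⟩ := aux_prod G (fun y => fSgn ε y * uGauss ε y) (x, y) _ _
    hGd ((aux_fd ε y hε).mul (aux_d1 ε y hε))
  have e2 : (fun q => fderiv ℝ (PhiAnsatz ε φ) q (0, 1)) =
      fun q : ℝ × ℝ => φ q.1 * ((deriv (uGauss ε) q.2 : ℝ) : ℂ) := by
    funext q
    obtain ⟨L, hL, -, h⟩ := aux_prod φ (uGauss ε) q _ _ (hdiff q.1).hasDerivAt (aux_d1 ε q.2 hε)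
    have : fderiv ℝ (PhiAnsatz ε φ) q = L := hL.fderiv
    rw [this, h, hu1]
  obtain ⟨L3, hL3, -, h3⟩ := aux_prod φ (deriv (uGauss ε)) (x, y) _ (deriv (deriv (uGauss ε)) y)
    (hdiff x).hasDerivAt (by
      rw [hu1]; exact (aux_d2 ε y hε).differentiableAt.hasDerivAt)
  unfold magLapAnsatz
  rw [e1, e2, hL3.fderiv, h3]
  unfold opA
  have e3 : fderiv ℝ (fun p : ℝ × ℝ => (Complex.I * deriv φ p.1) * (uGauss ε p.2 : ℝ)
      + G p.1 * ((fSgn ε p.2 * uGauss ε p.2 : ℝ) : ℂ)) (x, y) = L1 + L2 := (hL1.add hL2).fderiv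
  rw [e3, ContinuousLinearMap.add_apply, h1, h2]
  simp only [hG]
  push_cast
  linear_combination (deriv (deriv φ) x * (uGauss ε y : ℂ)^2) * Complex.I_sq

/-- Projection of the magnetic Laplacian of the quasi-1D ansatz onto the transverse
ground state: for every `x`,
`∫ [(−i∇+T)²Φ](x,y) u_ε(y) dy = −φ'' + (π²β²/3)|φ|⁴φ + φ ∫ (−u_ε'') u_ε`. -/
theorem magnetic_laplacian_projection (ε β : ℝ) (hε : 0 < ε)
    (φ : ℝ → ℂ) (hφ : ContDiff ℝ 2 φ) (x : ℝ) :
    (∫ y : ℝ, magLapAnsatz ε β φ (x, y) * ((uGauss ε y : ℝ) : ℂ))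
      = -(deriv (deriv φ) x)
        + ((Real.pi^2 * β^2 / 3 : ℝ) : ℂ) * ((‖φ x‖^4 : ℝ) : ℂ) * φ x
        + φ x * ((∫ y : ℝ, (-(deriv (deriv (uGauss ε)) y)) * uGauss ε y : ℝ) : ℂ) := by
  obtain ⟨C, hC⟩ := aux_mag ε β hε φ hφ x
  have hu2 : ∀ y, deriv (deriv (uGauss ε)) y = (y^2/ε^2 - 1/ε) * uGauss ε y := fun y => by
    have hu1 : deriv (uGauss ε) = fun y => -(y/ε) * uGauss ε y :=
      funext fun y => (aux_d1 ε y hε).deriv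
    rw [hu1]; exact (aux_d2 ε y hε).deriv
  have i4 : Integrable (fun y => -(deriv (deriv (uGauss ε)) y) * uGauss ε y) := by
    have h := ((aux_int ε hε).const_mul (1/ε)).sub ((aux_int2 ε hε).const_mul (1/ε^2))
    refine h.congr (Filter.Eventually.of_forall fun y => ?_)
    simp only [hu2, Pi.sub_apply]
    ring
  have j1 := (aux_int ε hε).ofReal (𝕜 := ℂ) |>.const_mul (-(deriv (deriv φ) x))
  have j2 := (aux_i1 ε hε).ofReal (𝕜 := ℂ) |>.const_mul C
  have j3 := (aux_i2 ε hε).ofReal (𝕜 := ℂ) |>.const_mul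
    (((Real.pi^2 * β^2 : ℝ) : ℂ) * ((‖φ x‖^4 : ℝ) : ℂ) * φ x)
  have j4 := i4.ofReal (𝕜 := ℂ) |>.const_mul (φ x)
  rw [integral_congr_ae (Filter.Eventually.of_forall hC)]
  refine (integral_add ((j1.add j2).add j3) j4).trans ?_
  refine (congrArg (· + _) ((integral_add (j1.add j2) j3).trans
    (congrArg (· + _) (integral_add j1 j2)))).trans ?_
  simp only [integral_const_mul]
  have k1 := congrArg (fun r : ℝ => (r : ℂ)) (aux_one ε hε)
  have k2 := congrArg (fun r : ℝ => (r : ℂ)) (aux_v1 ε hε)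
  have k3 := congrArg (fun r : ℝ => (r : ℂ)) (aux_v2 ε hε)
  simp only [← integral_complex_ofReal] at k1 k2 k3 ⊢
  simp only [RCLike.ofReal_eq_complex_ofReal] 
  rw [k1, k2, k3]
  push_cast
  ring
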